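/- arXiv:2205.01792 — 2 statements merged into one kernel-verified Lean document; each statement's English description precedes it below -/
import Mathlib

section
/- Let G be a group generated by a finite symmetric set S, acting faithfully and transitively on the right on a set V, with graph of the action Γ. Then for every R ≥ 1 the growth function of G satisfies γ_G(R) ≤ (δ_Γ(R)·γ_Γ(R))^{L(R)}. -/
noncomputable section

namespace ActionGrowth

variable {G V : Type} [Group G]

/-- The product in `G` of a word over the generating set `S`. -/
def wordProd (S : Set G) (w : List S) : G := (w.map (fun s => (s : G))).prod

/-- The (vertex set of the) ball of radius `R` centered at `v` in the graph of the
right action `act` of `G` on `V` with respect to the symmetric generating set `S`. -/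
def ball (act : V → G → V) (S : Set G) (v : V) (R : ℕ) : Set V :=
  {u | ∃ w : List S, w.length ≤ R ∧ act v (wordProd S w) = u}

/-- Graph distance in the graph of the action (for a symmetric generating set `S`). -/
def gdist (act : V → G → V) (S : Set G) (v u : V) : ℕ :=
  sInf {n | u ∈ ball act S v n}

/-- `R_w(v)`: the maximum over the prefixes `s₁ ⋯ s_i` of `w` of the distances
`d(v, v · s₁ ⋯ s_i)`, i.e. the minimal radius of a ball centered at `v`
containing the path labeled `w` starting at `v`. -/
def rad (act : V → G → V) (S : Set G) (w : List S) (v : V) : ℕ :=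
  (Finset.range (w.length + 1)).sup fun i => gdist act S v (act v (wordProd S (w.take i)))

/-- Isomorphism of the rooted labeled balls `(B_v(R), v)` and `(B_u(R), u)`:
a bijection of the balls sending root to root and preserving the labeled edges
of the spanned subgraphs. -/
def BallIso (act : V → G → V) (S : Set G) (R : ℕ) (v u : V) : Prop :=
  ∃ φ : V → V, Set.BijOn φ (ball act S v R) (ball act S u R) ∧ φ v = u ∧
    ∀ x ∈ ball act S v R, ∀ y ∈ ball act S v R, ∀ s : S,
      (act x (s : G) = y ↔ act (φ x) (s : G) = φ y)

/-- `δ_Γ(R)`: the number of isomorphism classes of rooted balls `(B_v(R), v)`. -/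
def ballTypes (act : V → G → V) (S : Set G) (R : ℕ) : ℕ :=
  Nat.card (Quot (BallIso act S R))

/-- `γ_Γ(R)`: the maximal number of vertices of a ball of radius `R` in `Γ`. -/
def graphGrowth (act : V → G → V) (S : Set G) (R : ℕ) : ℕ :=
  ⨆ v : V, Nat.card (ball act S v R)

/-- Isomorphism of the elements `(B_v(R_w(v)), v, v·w)` and `(B_u(R_w(u)), u, u·w)`
of the standard portrait of `w`: a bijection of the balls matching both roots and
preserving the labeled edges. -/
def PortraitRel (act : V → G → V) (S : Set G) (w : List S) (v u : V) : Prop :=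
  ∃ φ : V → V,
    Set.BijOn φ (ball act S v (rad act S w v)) (ball act S u (rad act S w u)) ∧
    φ v = u ∧ φ (act v (wordProd S w)) = act u (wordProd S w) ∧
    ∀ x ∈ ball act S v (rad act S w v), ∀ y ∈ ball act S v (rad act S w v), ∀ s : S,
      (act x (s : G) = y ↔ act (φ x) (s : G) = φ y)

/-- `#P_w`: the number of elements (isomorphism classes of bi-rooted balls)
of the standard portrait of the word `w`. -/
def portraitCard (act : V → G → V) (S : Set G) (w : List S) : ℕ :=
  Nat.card (Quot (PortraitRel act S w))

/-- The ball of radius `R` in the group `G` with respect to `S`: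
elements of word length at most `R`. -/
def ballG (S : Set G) (R : ℕ) : Set G :=
  {g | ∃ w : List S, w.length ≤ R ∧ wordProd S w = g}

/-- `γ_G(R)`: the growth function of `G` with respect to `S`. -/
def groupGrowth (S : Set G) (R : ℕ) : ℕ := Nat.card (ballG S R)

/-- `L(g)`: the minimal size of a standard portrait `P_w` among words `w`
representing `g`. -/
def Lg (act : V → G → V) (S : Set G) (g : G) : ℕ :=
  sInf {m | ∃ w : List S, wordProd S w = g ∧ portraitCard act S w = m}

/-- `L(R)`: the maximum of `L(g)` over elements with `|g| ≤ R`. -/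
def LR (act : V → G → V) (S : Set G) (R : ℕ) : ℕ :=
  ⨆ g : ballG S R, Lg act S (g : G)

/-- `N_p(w)^p = Σ_{(B,x,y) ∈ P_w} (#B)^{p-1}`, the sum over the isomorphism
classes of the standard portrait of `w`. -/
def Npow (act : V → G → V) (S : Set G) (w : List S) (p : ℝ) : ℝ :=
  ∑' q : Quot (PortraitRel act S w),
    (Nat.card (ball act S (Quot.out q) (rad act S w (Quot.out q))) : ℝ) ^ (p - 1)

/-- `N_p(w) = (Σ_{(B,x,y) ∈ P_w} (#B)^{p-1})^{1/p}`. -/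
def Np (act : V → G → V) (S : Set G) (w : List S) (p : ℝ) : ℝ :=
  Npow act S w p ^ (1 / p)

/-- `N_p(g)`: the infimum of `N_p(w)` over words `w` representing `g`. -/
def Npg (act : V → G → V) (S : Set G) (g : G) (p : ℝ) : ℝ :=
  sInf {x : ℝ | ∃ w : List S, wordProd S w = g ∧ Np act S w p = x}

/-- `N_p(R)`: the maximum of `N_p(g)` over elements of length at most `R`. -/
def NpR (act : V → G → V) (S : Set G) (R : ℕ) (p : ℝ) : ℝ :=
  sSup {x : ℝ | ∃ g ∈ ballG S R, Npg act S g p = x}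

lemma wordProd_append (S : Set G) (a b : List S) :
    wordProd S (a ++ b) = wordProd S a * wordProd S b := by
  simp [wordProd]

lemma act_wordProd_concat {act : V → G → V}
    (hact_mul : ∀ (v : V) (g h : G), act (act v g) h = act v (g * h))
    (S : Set G) (v : V) (a : List S) (s : S) :
    act v (wordProd S (a ++ [s])) = act (act v (wordProd S a)) (s : G) := by
  rw [hact_mul, wordProd_append]
  simp [wordProd]

lemma ball_mono (act : V → G → V) (S : Set G) (v : V) {m n : ℕ} (h : m ≤ n) :
    ball act S v m ⊆ ball act S v n :=
  fun _ ⟨w, hw, hu⟩ => ⟨w, hw.trans h, hu⟩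

lemma wordProd_mem_ball (act : V → G → V) (S : Set G) (v : V) {a : List S} {r : ℕ}
    (h : a.length ≤ r) : act v (wordProd S a) ∈ ball act S v r :=
  ⟨a, h, rfl⟩

lemma gdist_le_iff (act : V → G → V) (S : Set G) (v : V) (p : List S) (r : ℕ) :
    gdist act S v (act v (wordProd S p)) ≤ r ↔ act v (wordProd S p) ∈ ball act S v r := by
  constructor
  · intro h
    exact ball_mono act S v h
      (Nat.sInf_mem (s := {n | act v (wordProd S p) ∈ ball act S v n})
        ⟨p.length, wordProd_mem_ball act S v le_rfl⟩)
  · exact fun h => Nat.sInf_le h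

lemma rad_le_iff (act : V → G → V) (S : Set G) (w : List S) (v : V) (r : ℕ) :
    rad act S w v ≤ r ↔ ∀ p, p <+: w → act v (wordProd S p) ∈ ball act S v r := by
  rw [rad, Finset.sup_le_iff]
  constructor
  · intro h p hp
    rw [← gdist_le_iff, List.prefix_iff_eq_take.1 hp]
    exact h _ (Finset.mem_range.2 (Nat.lt_succ_of_le hp.length_le))
  · intro h i _
    rw [gdist_le_iff]
    exact h _ (List.take_prefix i w)

lemma rad_le_length (act : V → G → V) (S : Set G) (w : List S) (v : V) :
    rad act S w v ≤ w.length :=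
  (rad_le_iff act S w v _).2 fun _ hp => wordProd_mem_ball act S v hp.length_le

/-- The coincidences of words visible in the ball of radius `r` around `v`. They determine
the isomorphism class of this rooted labeled ball. -/
def coincidences (act : V → G → V) (S : Set G) (r : ℕ) (v : V) : Set (List S × List S) :=
  {p | (p.1.length ≤ r + 1 ∧ p.2.length ≤ r) ∧ act v (wordProd S p.1) = act v (wordProd S p.2)}

section coincidences

variable {act : V → G → V} {S : Set G} {r : ℕ} {v u : V}

lemma act_eq_iff_of_coincidences_eq
    (h : coincidences act S r v = coincidences act S r u) {a b : List S}
    (ha : a.length ≤ r + 1) (hb : b.length ≤ r) :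
    act v (wordProd S a) = act v (wordProd S b) ↔
      act u (wordProd S a) = act u (wordProd S b) := by
  have := Set.ext_iff.1 h (a, b)
  simpa [coincidences, ha, hb] using this

lemma coincidences_eq_of_le {m : ℕ} (hm : m ≤ r)
    (h : coincidences act S r v = coincidences act S r u) :
    coincidences act S m v = coincidences act S m u := by
  ext ⟨a, b⟩
  refine and_congr_right fun hab => ?_
  exact act_eq_iff_of_coincidences_eq h (hab.1.trans (by lia)) (hab.2.trans hm)

lemma finite_quot_of_coincidences (hSfin : S.Finite) {ρ : V → V → Prop} (n : ℕ)
    (h : ∀ v u, coincidences act S n v = coincidences act S n u → ρ v u) :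
    Finite (Quot ρ) := by
  have : Finite S := hSfin
  have hF := ((List.finite_length_le S (n + 1)).prod (List.finite_length_le S n)).finite_subsets
  have := hF.to_subtype
  refine Finite.of_injective
    (β := {s | s ⊆ {a : List S | a.length ≤ n + 1} ×ˢ {b : List S | b.length ≤ n}})
    (fun q : Quot ρ => ⟨coincidences act S n q.out, fun _ hp => hp.1⟩) fun q q' hq => ?_
  rw [← q.out_eq, ← q'.out_eq]
  exact Quot.sound (h _ _ (congrArg Subtype.val hq))

lemma map_act_wordProd
    (hact_one : ∀ v : V, act v 1 = v)
    (hact_mul : ∀ (v : V) (g h : G), act (act v g) h = act v (g * h))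
    {B : Set V} {φ : V → V} (hφ : φ v = u)
    (hedge : ∀ x ∈ B, ∀ y ∈ B, ∀ s : S, (act x (s : G) = y ↔ act (φ x) (s : G) = φ y))
    (a : List S) (ha : ∀ p, p <+: a → act v (wordProd S p) ∈ B) :
    φ (act v (wordProd S a)) = act u (wordProd S a) := by
  induction a using List.reverseRecOn with
  | nil => simp [wordProd, hact_one, hφ]
  | append_singleton a s ih =>
    have ih := ih fun p hp => ha p (hp.trans (List.prefix_append a [s]))
    rw [act_wordProd_concat hact_mul S u, ← ih]
    refine ((hedge _ (ha a (List.prefix_append a [s])) _ (ha _ List.prefix_rfl) s).1 ?_).symm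
    rw [act_wordProd_concat hact_mul S v]

lemma coincidences_eq_of_iso
    (hact_one : ∀ v : V, act v 1 = v)
    (hact_mul : ∀ (v : V) (g h : G), act (act v g) h = act v (g * h))
    {φ : V → V} (hφ : φ v = u) (hinj : Set.InjOn φ (ball act S v r))
    (hedge : ∀ x ∈ ball act S v r, ∀ y ∈ ball act S v r, ∀ s : S,
      (act x (s : G) = y ↔ act (φ x) (s : G) = φ y)) :
    coincidences act S r v = coincidences act S r u := by
  have key : ∀ a : List S, a.length ≤ r → φ (act v (wordProd S a)) = act u (wordProd S a) :=
    fun a ha => map_act_wordProd hact_one hact_mul hφ hedge a fun p hp =>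
      wordProd_mem_ball act S v (hp.length_le.trans ha)
  ext ⟨a, b⟩
  refine and_congr_right fun ⟨ha, hb⟩ => ?_
  dsimp only at ha hb ⊢
  rcases a.eq_nil_or_concat' with rfl | ⟨a, s, rfl⟩
  · rw [← key _ hb, ← key [] (Nat.zero_le _)]
    exact (hinj.eq_iff (wordProd_mem_ball act S v (Nat.zero_le _))
      (wordProd_mem_ball act S v hb)).symm
  · have ha : a.length ≤ r := by simpa using ha
    rw [act_wordProd_concat hact_mul, act_wordProd_concat hact_mul, ← key _ hb, ← key _ ha]
    exact hedge _ (wordProd_mem_ball act S v ha) _ (wordProd_mem_ball act S v hb) s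

lemma exists_iso_of_coincidences_eq
    (hact_one : ∀ v : V, act v 1 = v)
    (hact_mul : ∀ (v : V) (g h : G), act (act v g) h = act v (g * h))
    (h : coincidences act S r v = coincidences act S r u) :
    ∃ φ : V → V, Set.BijOn φ (ball act S v r) (ball act S u r) ∧ φ v = u ∧
      ∀ x ∈ ball act S v r, ∀ y ∈ ball act S v r, ∀ s : S,
        (act x (s : G) = y ↔ act (φ x) (s : G) = φ y) := by
  have hex : ∀ x, ∃ y, ∀ a : List S, a.length ≤ r → act v (wordProd S a) = x →
      act u (wordProd S a) = y := by
    intro x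
    by_cases hx : x ∈ ball act S v r
    · obtain ⟨b, hb, rfl⟩ := hx
      exact ⟨_, fun a ha hab =>
        (act_eq_iff_of_coincidences_eq h (ha.trans r.le_succ) hb).1 hab⟩
    · exact ⟨x, fun a ha hax => (hx ⟨a, ha, hax⟩).elim⟩
  choose φ hφ using hex
  have key : ∀ a : List S, a.length ≤ r → φ (act v (wordProd S a)) = act u (wordProd S a) :=
    fun a ha => (hφ _ a ha rfl).symm
  refine ⟨φ, ⟨?_, ?_, ?_⟩, ?_, ?_⟩
  · rintro _ ⟨a, ha, rfl⟩
    rw [key a ha]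
    exact wordProd_mem_ball act S u ha
  · rintro _ ⟨a, ha, rfl⟩ _ ⟨b, hb, rfl⟩ hab
    rw [key a ha, key b hb] at hab
    exact (act_eq_iff_of_coincidences_eq h (ha.trans r.le_succ) hb).2 hab
  · rintro _ ⟨a, ha, rfl⟩
    exact ⟨_, wordProd_mem_ball act S v ha, key a ha⟩
  · simpa [wordProd, hact_one] using key [] (Nat.zero_le _)
  · rintro _ ⟨a, ha, rfl⟩ _ ⟨b, hb, rfl⟩ s
    rw [key a ha, key b hb, ← act_wordProd_concat hact_mul, ← act_wordProd_concat hact_mul]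
    exact act_eq_iff_of_coincidences_eq h (by simpa using ha) hb

lemma act_word_eq_of_coincidences_eq
    (hact_one : ∀ v : V, act v 1 = v)
    (hact_mul : ∀ (v : V) (g h : G), act (act v g) h = act v (g * h))
    (h : coincidences act S r v = coincidences act S r u) {w a : List S}
    (hw : rad act S w v ≤ r) (ha : a.length ≤ r)
    (hwa : act v (wordProd S w) = act v (wordProd S a)) :
    act u (wordProd S w) = act u (wordProd S a) := by
  obtain ⟨φ, -, hφ, hedge⟩ := exists_iso_of_coincidences_eq hact_one hact_mul h
  rw [← map_act_wordProd hact_one hact_mul hφ hedge w ((rad_le_iff act S w v r).1 hw), hwa]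
  exact map_act_wordProd hact_one hact_mul hφ hedge a fun p hp =>
    wordProd_mem_ball act S v (hp.length_le.trans ha)

lemma rad_le_of_coincidences_eq {w : List S} (hw : w.length ≤ r)
    (h : coincidences act S r v = coincidences act S r u) :
    rad act S w u ≤ rad act S w v := by
  rw [rad_le_iff]
  intro p hp
  obtain ⟨a, ha, hap⟩ := (rad_le_iff act S w v _).1 le_rfl p hp
  refine ⟨a, ha, ?_⟩
  have har := ha.trans ((rad_le_length act S w v).trans hw)
  exact (act_eq_iff_of_coincidences_eq h (har.trans r.le_succ) (hp.length_le.trans hw)).1 hap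

lemma portraitRel_of_coincidences_eq
    (hact_one : ∀ v : V, act v 1 = v)
    (hact_mul : ∀ (v : V) (g h : G), act (act v g) h = act v (g * h)) {w : List S}
    (h : coincidences act S w.length v = coincidences act S w.length u) :
    PortraitRel act S w v u := by
  have hrad : rad act S w u = rad act S w v :=
    le_antisymm (rad_le_of_coincidences_eq le_rfl h) (rad_le_of_coincidences_eq le_rfl h.symm)
  obtain ⟨φ, hbij, hφ, hedge⟩ := exists_iso_of_coincidences_eq hact_one hact_mul
    (coincidences_eq_of_le (rad_le_length act S w v) h)
  exact ⟨φ, hrad ▸ hbij, hφ, map_act_wordProd hact_one hact_mul hφ hedge w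
    ((rad_le_iff act S w v _).1 le_rfl), hedge⟩

lemma coincidences_eq_of_portraitRel
    (hact_one : ∀ v : V, act v 1 = v)
    (hact_mul : ∀ (v : V) (g h : G), act (act v g) h = act v (g * h)) {w : List S}
    (h : PortraitRel act S w v u) :
    rad act S w v = rad act S w u ∧
      coincidences act S (rad act S w v) v = coincidences act S (rad act S w u) u := by
  obtain ⟨φ, hbij, hφ, -, hedge⟩ := h
  have hc := coincidences_eq_of_iso hact_one hact_mul hφ hbij.injOn hedge
  have hprefix : ∀ p, p <+: w → φ (act v (wordProd S p)) = act u (wordProd S p) :=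
    fun p hp => map_act_wordProd hact_one hact_mul hφ hedge p fun q hq =>
      (rad_le_iff act S w v _).1 le_rfl q (hq.trans hp)
  have hword : ∀ a : List S, a.length ≤ rad act S w v →
      φ (act v (wordProd S a)) = act u (wordProd S a) :=
    fun a ha => map_act_wordProd hact_one hact_mul hφ hedge a fun p hp =>
      wordProd_mem_ball act S v (hp.length_le.trans ha)
  have hle : rad act S w u ≤ rad act S w v := by
    rw [rad_le_iff]
    intro p hp
    obtain ⟨a, ha, hap⟩ := (rad_le_iff act S w v _).1 le_rfl p hp
    exact ⟨a, ha, by rw [← hword a ha, hap, hprefix p hp]⟩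
  have hge : rad act S w v ≤ rad act S w u := by
    rw [rad_le_iff]
    intro p hp
    obtain ⟨a, ha, hap⟩ := (rad_le_iff act S w u _).1 le_rfl p hp
    refine ⟨a, ha, hbij.injOn (wordProd_mem_ball act S v (ha.trans hle))
      ((rad_le_iff act S w v _).1 le_rfl p hp) ?_⟩
    rw [hword a (ha.trans hle), hap, hprefix p hp]
  have heq := le_antisymm hge hle
  exact ⟨heq, heq ▸ hc⟩

lemma coincidences_eq_of_quot_portraitRel_eq
    (hact_one : ∀ v : V, act v 1 = v)
    (hact_mul : ∀ (v : V) (g h : G), act (act v g) h = act v (g * h)) {w : List S}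
    (h : Quot.mk (PortraitRel act S w) v = Quot.mk (PortraitRel act S w) u) :
    coincidences act S (rad act S w v) v = coincidences act S (rad act S w v) u := by
  have := congrArg (Quot.lift
    (fun v => (rad act S w v, coincidences act S (rad act S w v) v)) fun a b hab =>
      have := coincidences_eq_of_portraitRel hact_one hact_mul hab
      Prod.ext this.1 this.2) h
  obtain ⟨h₁, h₂⟩ := Prod.ext_iff.1 this
  dsimp only at h₁ h₂
  rw [h₂, h₁]

lemma coincidences_eq_of_quot_ballIso_eq
    (hact_one : ∀ v : V, act v 1 = v)
    (hact_mul : ∀ (v : V) (g h : G), act (act v g) h = act v (g * h))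
    (h : Quot.mk (BallIso act S r) v = Quot.mk (BallIso act S r) u) :
    coincidences act S r v = coincidences act S r u :=
  congrArg (Quot.lift (coincidences act S r) fun _ _ ⟨_, hbij, hφ, hedge⟩ =>
    coincidences_eq_of_iso hact_one hact_mul hφ hbij.injOn hedge) h

/-- Truncating the portrait of `w` at radius `R` still determines the position of `v · w`,
as long as `w` represents an element of length at most `R`. -/
lemma exists_word_of_coincidences_eq
    (hact_one : ∀ v : V, act v 1 = v)
    (hact_mul : ∀ (v : V) (g h : G), act (act v g) h = act v (g * h))
    {R : ℕ} {w : List S} (hw : wordProd S w ∈ ballG S R) (v : V) :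
    ∃ a : List S, a.length ≤ min (rad act S w v) R ∧
      act v (wordProd S a) = act v (wordProd S w) ∧
      ∀ u, coincidences act S (min (rad act S w v) R) v =
          coincidences act S (min (rad act S w v) R) u →
        act u (wordProd S a) = act u (wordProd S w) := by
  rcases le_total (rad act S w v) R with h | h
  · rw [min_eq_left h]
    obtain ⟨a, ha, haw⟩ := (rad_le_iff act S w v _).1 le_rfl w List.prefix_rfl
    exact ⟨a, ha, haw, fun u hu =>
      (act_word_eq_of_coincidences_eq hact_one hact_mul hu le_rfl ha haw.symm).symm⟩
  · rw [min_eq_right h]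
    obtain ⟨a, ha, haw⟩ := hw
    exact ⟨a, ha, by rw [haw], fun u _ => by rw [haw]⟩

lemma finite_quot_ballIso
    (hSfin : S.Finite)
    (hact_one : ∀ v : V, act v 1 = v)
    (hact_mul : ∀ (v : V) (g h : G), act (act v g) h = act v (g * h)) (r : ℕ) :
    Finite (Quot (BallIso act S r)) :=
  finite_quot_of_coincidences hSfin r fun _ _ h =>
    exists_iso_of_coincidences_eq hact_one hact_mul h

lemma finite_quot_portraitRel
    (hSfin : S.Finite)
    (hact_one : ∀ v : V, act v 1 = v)
    (hact_mul : ∀ (v : V) (g h : G), act (act v g) h = act v (g * h)) (w : List S) :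
    Finite (Quot (PortraitRel act S w)) :=
  finite_quot_of_coincidences hSfin w.length fun _ _ h =>
    portraitRel_of_coincidences_eq hact_one hact_mul h

end coincidences

lemma finite_ballG {S : Set G} (hSfin : S.Finite) (R : ℕ) : (ballG S R).Finite := by
  have : Finite S := hSfin
  exact (List.finite_length_le S R).image (wordProd S)

lemma finite_ball {S : Set G} (hSfin : S.Finite) (act : V → G → V) (v : V) (R : ℕ) :
    (ball act S v R).Finite := by
  have : Finite S := hSfin
  exact (List.finite_length_le S R).image fun w => act v (wordProd S w)

lemma card_ball_le_graphGrowth {S : Set G} (hSfin : S.Finite) (act : V → G → V) (v : V) (R : ℕ) :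
    Nat.card (ball act S v R) ≤ graphGrowth act S R := by
  have : Finite S := hSfin
  refine le_ciSup (f := fun v => Nat.card (ball act S v R))
    ⟨{w : List S | w.length ≤ R}.ncard, ?_⟩ v
  rintro _ ⟨u, rfl⟩
  exact Set.ncard_image_le (f := fun w => act u (wordProd S w)) (List.finite_length_le S R)

lemma exists_word_portraitCard_le {S : Set G} (hSfin : S.Finite) (act : V → G → V) {R : ℕ}
    {g : G} (hg : g ∈ ballG S R) :
    ∃ w : List S, wordProd S w = g ∧ portraitCard act S w ≤ LR act S R := by
  obtain ⟨w, hwg, hw⟩ := Nat.sInf_mem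
    (s := {m | ∃ w : List S, wordProd S w = g ∧ portraitCard act S w = m})
    (let ⟨w, _, hw⟩ := hg; ⟨_, w, hw, rfl⟩)
  have := (finite_ballG hSfin R).to_subtype
  refine ⟨w, hwg, hw.trans_le ?_⟩
  exact le_ciSup (f := fun g : ballG S R => Lg act S (g : G)) (Set.finite_range _).bddAbove
    ⟨g, hg⟩

/-- Let `G` be a group generated by a finite symmetric set `S`,
acting faithfully and transitively on the right on a set `V`, with graph of the
action `Γ`. Then for every `R ≥ 1` the growth function of `G` satisfies
`γ_G(R) ≤ (δ_Γ(R)·γ_Γ(R))^{L(R)}`. -/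
theorem growth_le_portrait_bound
    (S : Set G) (hSfin : S.Finite) (hSsym : ∀ s ∈ S, s⁻¹ ∈ S)
    (hSgen : Subgroup.closure S = ⊤)
    (act : V → G → V)
    (hact_one : ∀ v : V, act v 1 = v)
    (hact_mul : ∀ (v : V) (g h : G), act (act v g) h = act v (g * h))
    (hfaithful : ∀ g : G, (∀ v : V, act v g = v) → g = 1)
    (htrans : ∀ u v : V, ∃ g : G, act u g = v) :
    ∀ R : ℕ, 1 ≤ R →
      groupGrowth S R ≤ (ballTypes act S R * graphGrowth act S R) ^ (LR act S R) := by
  intro R _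
  rcases isEmpty_or_nonempty V with hV | hV
  · have : Subsingleton G := ⟨fun g h => by
      rw [hfaithful g fun v => (hV.false v).elim, hfaithful h fun v => (hV.false v).elim]⟩
    have hL : LR act S R = 0 := by
      have hLg : ∀ g : ballG S R, Lg act S (g : G) = 0 := fun g =>
        Nat.sInf_eq_zero.2 <| Or.inl <| by
          obtain ⟨w, -, hw⟩ := g.2
          exact ⟨w, hw, by
            have : IsEmpty (Quot (PortraitRel act S w)) := ⟨fun q => hV.false q.out⟩
            simp [portraitCard]⟩
      exact Nat.le_zero.1 (ciSup_le' fun g => (hLg g).le)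
    rw [hL, pow_zero]
    exact Finite.card_le_one_iff_subsingleton.2 inferInstance
  · have hfin := finite_quot_ballIso hSfin hact_one hact_mul R
    have hballfin : ∀ v, Finite (ball act S v R) := fun v => (finite_ball hSfin act v R).to_subtype
    choose w hwg hwL using fun g : ballG S R => exists_word_portraitCard_le hSfin act g.2
    have hsurj : ∀ g, ∃ f : Fin (LR act S R) → Quot (PortraitRel act S (w g)),
        Function.Surjective f := by
      intro g
      have := finite_quot_portraitRel hSfin hact_one hact_mul (w g)
      have : Nonempty (Quot (PortraitRel act S (w g))) := hV.map (Quot.mk _)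
      let e := Finite.equivFin (Quot (PortraitRel act S (w g)))
      have hinj : Function.Injective fun q => Fin.castLE (hwL g) (e q) :=
        (Fin.castLE_injective (hwL g)).comp e.injective
      exact ⟨_, Function.invFun_surjective hinj⟩
    choose f hf using hsurj
    let c (g : ballG S R) (i : Fin (LR act S R)) : Quot (BallIso act S R) :=
      Quot.mk _ (f g i).out
    have hmem : ∀ (g : ballG S R) (v : V), act v (g : G) ∈ ball act S v R := by
      rintro ⟨_, a, ha, rfl⟩ v
      exact wordProd_mem_ball act S v ha
    let code (g : ballG S R) (i : Fin (LR act S R)) :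
        Σ q : Quot (BallIso act S R), ball act S q.out R :=
      ⟨c g i, act (c g i).out (g : G), hmem g _⟩
    have hmatch : ∀ (g : ballG S R) (v : V), ∃ i,
        coincidences act S (min (rad act S (w g) v) R) v =
          coincidences act S (min (rad act S (w g) v) R) (c g i).out := by
      intro g v
      obtain ⟨i, hi⟩ := hf g (Quot.mk _ v)
      refine ⟨i, ?_⟩
      have h₁ : coincidences act S (rad act S (w g) v) v =
          coincidences act S (rad act S (w g) v) (f g i).out :=
        coincidences_eq_of_quot_portraitRel_eq hact_one hact_mul
          (by rw [Quot.out_eq, hi])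
      have h₂ : coincidences act S R (f g i).out = coincidences act S R (c g i).out :=
        coincidences_eq_of_quot_ballIso_eq hact_one hact_mul (Quot.out_eq (c g i)).symm
      exact (coincidences_eq_of_le (min_le_left _ _) h₁).trans
        (coincidences_eq_of_le (min_le_right _ _) h₂)
    have hcode_out : ∀ {g h : ballG S R}, code g = code h → ∀ i,
        act (c g i).out (g : G) = act (c g i).out (h : G) := by
      intro g h hgh i
      have hi : code g i = code h i := congrFun hgh i
      have hc : c g i = c h i := congrArg Sigma.fst hi
      have hval := congrArg (fun p : Σ q : Quot (BallIso act S R), ball act S q.out R =>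
        (p.2 : V)) hi
      exact hval.trans (by rw [hc])
    have hact_eq : ∀ (g h : ballG S R) (v : V), code g = code h →
        min (rad act S (w h) v) R ≤ min (rad act S (w g) v) R →
        act v (g : G) = act v (h : G) := by
      intro g h v hgh hle
      obtain ⟨i, hi⟩ := hmatch g v
      obtain ⟨a, ha, hav, hau⟩ := exists_word_of_coincidences_eq hact_one hact_mul
        (w := w g) (R := R) (by rw [hwg]; exact g.2) v
      obtain ⟨b, hb, hbv, hbu⟩ := exists_word_of_coincidences_eq hact_one hact_mul
        (w := w h) (R := R) (by rw [hwg]; exact h.2) v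
      have hau := hau _ hi
      have hbu := hbu _ (coincidences_eq_of_le hle hi)
      rw [hwg] at hav hau hbv hbu
      rw [← hav, ← hbv]
      refine (act_eq_iff_of_coincidences_eq hi (ha.trans (Nat.le_succ _)) (hb.trans hle)).2 ?_
      rw [hau, hbu]
      exact hcode_out hgh i
    have hinj : Function.Injective code := by
      intro g h hgh
      have hv : ∀ v, act v (g : G) = act v (h : G) := fun v =>
        (le_total (min (rad act S (w h) v) R) (min (rad act S (w g) v) R)).elim
          (hact_eq g h v hgh) fun hle => (hact_eq h g v hgh.symm hle).symm
      refine Subtype.ext (mul_inv_eq_one.1 (hfaithful _ fun v => ?_))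
      rw [← hact_mul, hv, hact_mul, mul_inv_cancel, hact_one]
    calc groupGrowth S R
        ≤ Nat.card (Fin (LR act S R) → Σ q : Quot (BallIso act S R), ball act S q.out R) :=
          Nat.card_le_card_of_injective code hinj
      _ = Nat.card (Σ q : Quot (BallIso act S R), ball act S q.out R) ^ LR act S R := by
          simp [Nat.card_fun]
      _ ≤ (ballTypes act S R * graphGrowth act S R) ^ LR act S R := by
          refine Nat.pow_le_pow_left ?_ _
          have := Fintype.ofFinite (Quot (BallIso act S R))
          rw [Nat.card_sigma, ballTypes, Nat.card_eq_fintype_card]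
          exact Finset.sum_le_card_nsmul _ _ _ fun q _ => card_ball_le_graphGrowth hSfin act _ R

end ActionGrowth
end
end

section
/- Let Γ be the graph of a faithful transitive right action of a group G generated by a finite symmetric set S. Assume: (1) there exist constants C, d ≥ 1 such that C^{-1}·R^d ≤ #B_v(R) ≤ C·R^d for every vertex v and every R ≥ 1; (2) Γ is linearly repetitive, i.e. there exists L > 1 such that for all vertices v, v' and every R > 0 there is an isomorphic embedding of labeled graphs of B_v(R) into B_{v'}(LR). Then there is a constant K such that δ_Γ(R) ≤ K·R^d for all R ≥ 1. -/
noncomputable section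

namespace ActionGrowth

variable {G V : Type} [Group G]

/-- An isomorphic embedding of the labeled ball `B_v(R)` into the labeled ball
`B_{v'}(R')`: an injective map of the first ball into the second preserving (in
both directions) the labeled edges of the spanned subgraphs. -/
def IsBallEmbedding (act : V → G → V) (S : Set G) (v v' : V) (R R' : ℕ) (ψ : V → V) : Prop :=
  Set.InjOn ψ (ball act S v R) ∧
  Set.MapsTo ψ (ball act S v R) (ball act S v' R') ∧
  ∀ x ∈ ball act S v R, ∀ y ∈ ball act S v R, ∀ s : S,
    (act x (s : G) = y ↔ act (ψ x) (s : G) = ψ y)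

theorem wordProd_append_singleton (S : Set G) (w : List S) (s : S) :
    wordProd S (w ++ [s]) = wordProd S w * (s : G) := by
  simp [wordProd]

theorem self_mem_ball {act : V → G → V} (hact_one : ∀ v : V, act v 1 = v)
    (S : Set G) (v : V) (R : ℕ) : v ∈ ball act S v R :=
  ⟨[], Nat.zero_le R, by simp [wordProd, hact_one]⟩

/-- An embedding of labeled balls commutes with the words whose length is at most the radius. -/
theorem IsBallEmbedding.map_act_wordProd {act : V → G → V}
    (hact_one : ∀ v : V, act v 1 = v)
    (hact_mul : ∀ (v : V) (g h : G), act (act v g) h = act v (g * h))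
    {S : Set G} {v v' : V} {R R' : ℕ} {ψ : V → V} (h : IsBallEmbedding act S v v' R R' ψ)
    (w : List S) (hw : w.length ≤ R) :
    ψ (act v (wordProd S w)) = act (ψ v) (wordProd S w) := by
  induction w using List.reverseRecOn with
  | nil => simp [wordProd, hact_one]
  | append_singleton w s ih =>
    have hlen : w.length ≤ R := by
      simp only [List.length_append, List.length_singleton] at hw
      omega
    have hedge := (h.2.2 _ ⟨w, hlen, rfl⟩ _ ⟨w ++ [s], hw, rfl⟩ s).1
      (by rw [wordProd_append_singleton, hact_mul])
    rw [← hedge, ih hlen, wordProd_append_singleton, hact_mul]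

/-- An embedding of a labeled ball maps it onto the ball of the same radius around the image
of its center. -/
theorem IsBallEmbedding.bijOn {act : V → G → V}
    (hact_one : ∀ v : V, act v 1 = v)
    (hact_mul : ∀ (v : V) (g h : G), act (act v g) h = act v (g * h))
    {S : Set G} {v v' : V} {R R' : ℕ} {ψ : V → V} (h : IsBallEmbedding act S v v' R R' ψ) :
    Set.BijOn ψ (ball act S v R) (ball act S (ψ v) R) := by
  refine ⟨?_, h.1, ?_⟩
  · rintro _ ⟨w, hw, rfl⟩
    exact ⟨w, hw, (h.map_act_wordProd hact_one hact_mul w hw).symm⟩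
  · rintro _ ⟨w, hw, rfl⟩
    exact ⟨_, ⟨w, hw, rfl⟩, h.map_act_wordProd hact_one hact_mul w hw⟩

/-- Two balls are isomorphic as rooted labeled graphs if they have embeddings sending
their centers to the same vertex. -/
theorem IsBallEmbedding.ballIso {act : V → G → V}
    (hact_one : ∀ v : V, act v 1 = v)
    (hact_mul : ∀ (v : V) (g h : G), act (act v g) h = act v (g * h))
    {S : Set G} {v u v' u' : V} {R R₁ R₂ : ℕ} {ψ χ : V → V}
    (hψ : IsBallEmbedding act S v v' R R₁ ψ) (hχ : IsBallEmbedding act S u u' R R₂ χ)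
    (h : ψ v = χ u) : BallIso act S R v u := by
  have hbψ := hψ.bijOn hact_one hact_mul
  have hbχ := hχ.bijOn hact_one hact_mul
  rw [h] at hbψ
  have : Nonempty V := ⟨v⟩
  have hinv := hbχ.invOn_invFunOn
  have hbij := (Set.bijOn_comm hinv).2 hbχ |>.comp hbψ
  refine ⟨_, hbij, ?_, fun x hx y hy s => ?_⟩
  · rw [Function.comp_apply, h, hinv.1 (self_mem_ball hact_one S u R)]
  · rw [hψ.2.2 x hx y hy s, hχ.2.2 _ (hbij.mapsTo hx) _ (hbij.mapsTo hy) s,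
      Function.comp_apply, Function.comp_apply, hinv.2 (hbψ.mapsTo hx),
      hinv.2 (hbψ.mapsTo hy)]

/-- If all balls of radius `R` embed into one finite ball, then the number of isomorphism
classes of balls of radius `R` is at most the number of vertices of that ball. -/
theorem ballTypes_le_card_ball {act : V → G → V}
    (hact_one : ∀ v : V, act v 1 = v)
    (hact_mul : ∀ (v : V) (g h : G), act (act v g) h = act v (g * h))
    {S : Set G} {v₀ : V} {R R' : ℕ} (hfin : Finite (ball act S v₀ R'))
    (hemb : ∀ v : V, ∃ ψ : V → V, IsBallEmbedding act S v v₀ R R' ψ) :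
    ballTypes act S R ≤ Nat.card (ball act S v₀ R') := by
  choose ψ hψ using hemb
  refine Nat.card_le_card_of_injective
    (fun q : Quot (BallIso act S R) =>
      (⟨ψ q.out q.out, (hψ q.out).2.1 (self_mem_ball hact_one S q.out R)⟩ : ball act S v₀ R'))
    fun p q hpq => ?_
  rw [← Quot.out_eq p, ← Quot.out_eq q]
  exact Quot.sound ((hψ p.out).ballIso hact_one hact_mul (hψ q.out) (congrArg Subtype.val hpq))

/-- Assume (1) `C⁻¹·R^d ≤ #B_v(R) ≤ C·R^d` for some `C, d ≥ 1`,
all vertices `v` and all `R ≥ 1`, and (2) `Γ` is linearly repetitive with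
constant `L > 1`. Then there is a constant `K` with `δ_Γ(R) ≤ K·R^d` for all
`R ≥ 1`. -/
theorem ballTypes_poly_of_linearlyRepetitive
    (S : Set G) (hSfin : S.Finite) (hSsym : ∀ s ∈ S, s⁻¹ ∈ S)
    (hSgen : Subgroup.closure S = ⊤)
    (act : V → G → V)
    (hact_one : ∀ v : V, act v 1 = v)
    (hact_mul : ∀ (v : V) (g h : G), act (act v g) h = act v (g * h))
    (hfaithful : ∀ g : G, (∀ v : V, act v g = v) → g = 1)
    (htrans : ∀ u v : V, ∃ g : G, act u g = v)
    -- condition (1): polynomial growth of the balls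
    (C d : ℝ) (hC : 1 ≤ C) (hd : 1 ≤ d)
    (hball : ∀ (v : V) (R : ℕ), 1 ≤ R →
      C⁻¹ * (R : ℝ) ^ d ≤ (Nat.card (ball act S v R) : ℝ) ∧
      (Nat.card (ball act S v R) : ℝ) ≤ C * (R : ℝ) ^ d)
    -- condition (2): linear repetitivity
    (L : ℝ) (hL : 1 < L)
    (hrep : ∀ (v v' : V) (R : ℕ), 0 < R → ∃ ψ : V → V,
      IsBallEmbedding act S v v' R ⌊L * (R : ℝ)⌋₊ ψ) :
    ∃ K : ℝ, ∀ R : ℕ, 1 ≤ R → (ballTypes act S R : ℝ) ≤ K * (R : ℝ) ^ d := by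
  refine ⟨C * L ^ d, fun R hR => ?_⟩
  have hL0 : 0 ≤ L := by linarith
  rcases isEmpty_or_nonempty V with hV | ⟨⟨v₀⟩⟩
  · have : IsEmpty (Quot (BallIso act S R)) := ⟨fun q => hV.elim q.out⟩
    rw [ballTypes, Nat.card_of_isEmpty, Nat.cast_zero]
    positivity
  have hR1 : (1 : ℝ) ≤ R := by exact_mod_cast hR
  have hfloor : 1 ≤ ⌊L * (R : ℝ)⌋₊ := Nat.one_le_floor_iff _ |>.2 (by nlinarith)
  obtain ⟨hlower, hupper⟩ := hball v₀ _ hfloor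
  have hpos : 0 < Nat.card (ball act S v₀ ⌊L * (R : ℝ)⌋₊) := by
    have : (0 : ℝ) < ⌊L * (R : ℝ)⌋₊ := by exact_mod_cast hfloor
    exact Nat.cast_pos.1 (lt_of_lt_of_le (by positivity) hlower)
  calc (ballTypes act S R : ℝ)
      ≤ Nat.card (ball act S v₀ ⌊L * (R : ℝ)⌋₊) := by
        exact_mod_cast ballTypes_le_card_ball hact_one hact_mul
          (Nat.finite_of_card_ne_zero hpos.ne') fun v => hrep v v₀ R hR
    _ ≤ C * (⌊L * (R : ℝ)⌋₊ : ℝ) ^ d := hupper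
    _ ≤ C * (L * R) ^ d := by
        gcongr
        exact Nat.floor_le (by positivity)
    _ = C * L ^ d * (R : ℝ) ^ d := by
        rw [Real.mul_rpow hL0 (Nat.cast_nonneg R), mul_assoc]

end ActionGrowth
end
end
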